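/- (b > 1 data forging for fully connected networks.) Let f_θ be an L-layer fully connected network with differentiable activation h, input dimension d and first hidden-layer width d₁, and let B = (x^{(1)}, y^{(1)}), …, (x^{(b)}, y^{(b)}) be a mini-batch with x^{(k)} ∈ ℝ^d, y^{(k)} ∈ ℝ^n. Let D₁ ∈ ℝ^{b×d₁} be the matrix whose k-th row is the gradient of the per-example loss at (x^{(k)}, y^{(k)}) with respect to the first-layer bias b₁. Then: (i) for every P ∈ ℝ^{d×b} satisfying P·D₁ = 0 and W₁ᵀ·P = 0, the perturbed mini-batch B' = (x^{(1)} + p^{(1)}, y^{(1)}), …, (x^{(b)} + p^{(b)}, y^{(b)}) (p^{(k)} the k-th column of P) satisfies that the gradients of the batch loss L(B'; θ) with respect to every weight matrix W_i and every bias b_i equal the corresponding gradients of L(B; θ); and (ii) if d·b > d₁·(d + b), there exist infinitely many such matrices P, including nonzero ones. -/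

import Mathlib

open scoped BigOperators

/-- `softmax z i = exp (z i) / ∑ j, exp (z j)`. -/
noncomputable def softmax {n : ℕ} (z : Fin n → ℝ) : Fin n → ℝ :=
  fun i => Real.exp (z i) / ∑ j, Real.exp (z j)

/-- Cross-entropy loss `ℓ(ŷ, y) = -∑ i, y i * log (ŷ i)`. -/
noncomputable def xent {n : ℕ} (yhat y : Fin n → ℝ) : ℝ :=
  -∑ i, y i * Real.log (yhat i)

/-- `tmulVec W x = Wᵀ x`, i.e. `(tmulVec W x) j = ∑ m, W m j * x m`. -/
def tmulVec {d n : ℕ} (W : Fin d → Fin n → ℝ) (x : Fin d → ℝ) : Fin n → ℝ :=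
  fun j => ∑ m, W m j * x m

/-- Activations of a fully connected network: `activ 0 x = x` and
`activ (i+1) x = h (Wᵢᵀ (activ i x) + bᵢ)` coordinatewise. -/
noncomputable def activ (h : ℝ → ℝ) (dims : ℕ → ℕ)
    (W : ∀ i : ℕ, Fin (dims i) → Fin (dims (i + 1)) → ℝ)
    (bias : ∀ i : ℕ, Fin (dims (i + 1)) → ℝ) :
    (i : ℕ) → (Fin (dims 0) → ℝ) → Fin (dims i) → ℝ
  | 0 => fun x => x
  | (i + 1) => fun x j => h (tmulVec (W i) (activ h dims W bias i x) j + bias i j)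

/-- Pre-activation `z_{i+1} = Wᵢᵀ aᵢ + bᵢ` of layer `i` of a fully connected network. -/
noncomputable def preact (h : ℝ → ℝ) (dims : ℕ → ℕ)
    (W : ∀ i : ℕ, Fin (dims i) → Fin (dims (i + 1)) → ℝ)
    (bias : ∀ i : ℕ, Fin (dims (i + 1)) → ℝ) (i : ℕ) (x : Fin (dims 0) → ℝ) :
    Fin (dims (i + 1)) → ℝ :=
  fun j => tmulVec (W i) (activ h dims W bias i x) j + bias i j

/-- Batch cross-entropy loss of an `(L+1)`-layer fully connected network:
`L(B; θ) = (1/b) ∑ k, ℓ(f_θ(x⁽ᵏ⁾), y⁽ᵏ⁾)`. -/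
noncomputable def batchNetLoss (h : ℝ → ℝ) (dims : ℕ → ℕ) (L b : ℕ)
    (W : ∀ i : ℕ, Fin (dims i) → Fin (dims (i + 1)) → ℝ)
    (bias : ∀ i : ℕ, Fin (dims (i + 1)) → ℝ)
    (X : Fin b → Fin (dims 0) → ℝ) (Y : Fin b → Fin (dims (L + 1)) → ℝ) : ℝ :=
  (1 / (b : ℝ)) * ∑ k, xent (softmax (preact h dims W bias L (X k))) (Y k)

theorem activ_congr (h : ℝ → ℝ) (dims : ℕ → ℕ)
    (W W' : ∀ i : ℕ, Fin (dims i) → Fin (dims (i + 1)) → ℝ)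
    (bias bias' : ∀ i : ℕ, Fin (dims (i + 1)) → ℝ) (x x' : Fin (dims 0) → ℝ)
    (hW : ∀ i, W (i + 1) = W' (i + 1)) (hB : ∀ i, bias (i + 1) = bias' (i + 1))
    (h0 : tmulVec (W 0) x + bias 0 = tmulVec (W' 0) x' + bias' 0) (i : ℕ) :
    activ h dims W bias (i + 1) x = activ h dims W' bias' (i + 1) x' := by
  induction i with
  | zero =>
    funext j
    have := congrFun h0 j
    simp only [Pi.add_apply] at this
    simp only [activ]
    rw [this]
  | succ i ih =>
    funext j
    change h (tmulVec (W (i + 1)) (activ h dims W bias (i + 1) x) j + bias (i + 1) j) =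
      h (tmulVec (W' (i + 1)) (activ h dims W' bias' (i + 1) x') j + bias' (i + 1) j)
    rw [ih, hW, hB]

theorem preact_congr (h : ℝ → ℝ) (dims : ℕ → ℕ)
    (W W' : ∀ i : ℕ, Fin (dims i) → Fin (dims (i + 1)) → ℝ)
    (bias bias' : ∀ i : ℕ, Fin (dims (i + 1)) → ℝ) (x x' : Fin (dims 0) → ℝ)
    (hW : ∀ i, W (i + 1) = W' (i + 1)) (hB : ∀ i, bias (i + 1) = bias' (i + 1))
    (h0 : tmulVec (W 0) x + bias 0 = tmulVec (W' 0) x' + bias' 0) (i : ℕ) :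
    preact h dims W bias i x = preact h dims W' bias' i x' := by
  cases i with
  | zero => exact h0
  | succ i =>
    funext j
    rw [preact, preact, activ_congr h dims W W' bias bias' x x' hW hB h0, hW, hB]

theorem tmulVec_zero' {d n : ℕ} (W : Fin d → Fin n → ℝ) : tmulVec W 0 = 0 := by
  funext j; simp [tmulVec]

theorem activ_diff (h : ℝ → ℝ) (hdiff : Differentiable ℝ h) (dims : ℕ → ℕ)
    (W : ∀ i : ℕ, Fin (dims i) → Fin (dims (i + 1)) → ℝ)
    (bias : ∀ i : ℕ, Fin (dims (i + 1)) → ℝ) (x : Fin (dims 0) → ℝ) (i : ℕ) :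
    Differentiable ℝ (fun z : Fin (dims 1) → ℝ =>
      activ h dims W (Function.update bias 0 z) i x) := by
  induction i with
  | zero => exact differentiable_const _
  | succ i ih =>
    rw [differentiable_pi]
    intro j
    simp only [activ, tmulVec]
    refine hdiff.comp ?_
    refine Differentiable.add ?_ ?_
    · refine Differentiable.fun_sum fun m _ => ?_
      exact ((differentiable_pi.1 ih) m).const_mul _
    · cases i with
      | zero => simp only [Function.update_self]; fun_prop
      | succ i =>
        simp only [Function.update_of_ne (Nat.succ_ne_zero i)]
        fun_prop

theorem preact_diff (h : ℝ → ℝ) (hdiff : Differentiable ℝ h) (dims : ℕ → ℕ)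
    (W : ∀ i : ℕ, Fin (dims i) → Fin (dims (i + 1)) → ℝ)
    (bias : ∀ i : ℕ, Fin (dims (i + 1)) → ℝ) (x : Fin (dims 0) → ℝ) (i : ℕ) :
    Differentiable ℝ (fun z : Fin (dims 1) → ℝ =>
      preact h dims W (Function.update bias 0 z) i x) := by
  have ih := activ_diff h hdiff dims W bias x i
  rw [differentiable_pi]
  intro j
  simp only [preact, tmulVec]
  refine Differentiable.add ?_ ?_
  · refine Differentiable.fun_sum fun m _ => ?_
    exact ((differentiable_pi.1 ih) m).const_mul _
  · cases i with
    | zero => simp only [Function.update_self]; fun_prop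
    | succ i =>
      simp only [Function.update_of_ne (Nat.succ_ne_zero i)]
      fun_prop

theorem xent_softmax_diff {n : ℕ} (y : Fin n → ℝ) :
    Differentiable ℝ (fun z : Fin n → ℝ => xent (softmax z) y) := by
  simp only [xent, softmax]
  refine Differentiable.fun_neg (Differentiable.fun_sum fun i _ => ?_)
  have hpos : ∀ z : Fin n → ℝ, 0 < ∑ j, Real.exp (z j) := fun z =>
    Finset.sum_pos (fun j _ => Real.exp_pos _) ⟨i, Finset.mem_univ i⟩
  refine Differentiable.const_mul (Differentiable.log ?_ ?_) _
  · have h1 : Differentiable ℝ (fun z : Fin n → ℝ => Real.exp (z i)) := by fun_prop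
    have h2 : Differentiable ℝ (fun z : Fin n → ℝ => ∑ j, Real.exp (z j)) := by fun_prop
    simp only [div_eq_mul_inv]
    exact fun z => (h1 z).mul ((h2 z).inv (hpos z).ne')
  · intro z
    exact (div_pos (Real.exp_pos _) (hpos z)).ne'

/-- `V ↦ Vᵀ x` as a continuous linear map. -/
noncomputable def tmulCLM {d n : ℕ} (x : Fin d → ℝ) :
    (Fin d → Fin n → ℝ) →L[ℝ] (Fin n → ℝ) :=
  LinearMap.toContinuousLinearMap
    { toFun := fun V => tmulVec V x
      map_add' := fun V V' => by
        funext j; simp [tmulVec, add_mul, Finset.sum_add_distrib]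
      map_smul' := fun c V => by
        funext j; simp [tmulVec, Finset.mul_sum, mul_assoc] }

theorem tmulCLM_apply {d n : ℕ} (x : Fin d → ℝ) (V : Fin d → Fin n → ℝ) :
    tmulCLM x V = tmulVec V x := rfl

theorem tmulVec_add' {d n : ℕ} (W : Fin d → Fin n → ℝ) (x p : Fin d → ℝ) :
    tmulVec W (x + p) = tmulVec W x + tmulVec W p := by
  funext j; simp [tmulVec, mul_add, Finset.sum_add_distrib]

/-- `b > 1` data forging for fully connected networks. Let `D₁` be the matrix whose
`k`-th row is the gradient of the per-example loss at `(x⁽ᵏ⁾, y⁽ᵏ⁾)` with respect to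
the first-layer bias. (i) Every `P` with `P·D₁ = 0` and `W₁ᵀ·P = 0` yields a
perturbed mini-batch `B' = (x⁽ᵏ⁾ + p⁽ᵏ⁾, y⁽ᵏ⁾)ₖ` whose batch-loss gradients with
respect to every weight matrix and every bias agree with those of `B`; and
(ii) if `d·b > d₁·(d + b)` there are infinitely many such `P`, including nonzero
ones. -/
theorem batch_forging_fcn (L : ℕ) (dims : ℕ → ℕ) (h : ℝ → ℝ)
    (hdiff : Differentiable ℝ h) (b : ℕ) (hb : 1 ≤ b)
    (W : ∀ i : ℕ, Fin (dims i) → Fin (dims (i + 1)) → ℝ)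
    (bias : ∀ i : ℕ, Fin (dims (i + 1)) → ℝ)
    (X : Fin b → Fin (dims 0) → ℝ) (Y : Fin b → Fin (dims (L + 1)) → ℝ)
    (D₁ : Fin b → Fin (dims 1) → ℝ)
    (hD₁ : ∀ k j, D₁ k j = fderiv ℝ (fun β : Fin (dims 1) → ℝ =>
        xent (softmax (preact h dims W (Function.update bias 0 β) L (X k))) (Y k))
        (bias 0) (Pi.single j (1 : ℝ))) :
    (∀ P : Fin (dims 0) → Fin b → ℝ,
      (∀ m j, ∑ k, P m k * D₁ k j = 0) →
      (∀ j k, ∑ m, W 0 m j * P m k = 0) →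
      ∀ i : ℕ, i ≤ L →
        (fderiv ℝ (fun V : Fin (dims i) → Fin (dims (i + 1)) → ℝ =>
            batchNetLoss h dims L b (Function.update W i V) bias
              (fun k => X k + fun m => P m k) Y) (W i)
          = fderiv ℝ (fun V : Fin (dims i) → Fin (dims (i + 1)) → ℝ =>
            batchNetLoss h dims L b (Function.update W i V) bias X Y) (W i)) ∧
        (fderiv ℝ (fun β : Fin (dims (i + 1)) → ℝ =>
            batchNetLoss h dims L b W (Function.update bias i β)
              (fun k => X k + fun m => P m k) Y) (bias i)
          = fderiv ℝ (fun β : Fin (dims (i + 1)) → ℝ =>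
            batchNetLoss h dims L b W (Function.update bias i β) X Y) (bias i))) ∧
    (dims 1 * (dims 0 + b) < dims 0 * b →
      (∃ P : Fin (dims 0) → Fin b → ℝ, P ≠ 0 ∧
        (∀ m j, ∑ k, P m k * D₁ k j = 0) ∧ (∀ j k, ∑ m, W 0 m j * P m k = 0)) ∧
      {P : Fin (dims 0) → Fin b → ℝ |
        (∀ m j, ∑ k, P m k * D₁ k j = 0) ∧
        (∀ j k, ∑ m, W 0 m j * P m k = 0)}.Infinite) := by
  classical
  constructor
  · intro P hPD hWP
    have hz : ∀ k, tmulVec (W 0) (fun m => P m k) = 0 := fun k => funext fun j => hWP j k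
    intro i hi
    constructor
    · rcases i with _ | i
      · -- first layer weights
        let G : Fin b → (Fin (dims 1) → ℝ) → ℝ := fun k z =>
          xent (softmax (preact h dims W (Function.update bias 0 z) L 0)) (Y k)
        have hG : ∀ k, Differentiable ℝ (G k) := fun k =>
          (xent_softmax_diff (Y k)).comp (preact_diff h hdiff dims W bias 0 L)
        have hD : ∀ k j, D₁ k j =
            fderiv ℝ (G k) (tmulVec (W 0) (X k) + bias 0) (Pi.single j (1 : ℝ)) := by
          intro k j
          rw [hD₁ k j, ← fderiv_comp_add_left]
          congr 2
          funext β
          simp only [G]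
          rw [preact_congr h dims W W _ _ (X k) 0 (fun _ => rfl) _ _ L]
          · intro i
            simp only [Function.update_of_ne (Nat.succ_ne_zero i)]
          · simp [tmulVec_zero']
        have hL : ∀ X' : Fin b → Fin (dims 0) → ℝ,
            (fun V : Fin (dims 0) → Fin (dims (0 + 1)) → ℝ =>
              batchNetLoss h dims L b (Function.update W 0 V) bias X' Y) =
            fun V => (1 / (b : ℝ)) * ∑ k, G k (tmulCLM (X' k) V + bias 0) := by
          intro X'
          funext V
          simp only [batchNetLoss, G]
          congr 1
          refine Finset.sum_congr rfl fun k _ => ?_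
          rw [preact_congr h dims _ W bias
            (Function.update bias 0 (tmulCLM (X' k) V + bias 0)) (X' k) 0 _ _ _ L]
          · intro i
            simp only [Function.update_of_ne (Nat.succ_ne_zero i)]
          · intro i
            simp only [Function.update_of_ne (Nat.succ_ne_zero i)]
          · simp [tmulVec_zero', tmulCLM_apply]
        have hF : ∀ X' : Fin b → Fin (dims 0) → ℝ,
            HasFDerivAt (fun V : Fin (dims 0) → Fin (dims (0 + 1)) → ℝ =>
              batchNetLoss h dims L b (Function.update W 0 V) bias X' Y)
              ((1 / (b : ℝ)) • ∑ k, (fderiv ℝ (G k) (tmulVec (W 0) (X' k) + bias 0)).comp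
                (tmulCLM (X' k))) (W 0) := by
          intro X'
          rw [hL]
          refine HasFDerivAt.const_mul (HasFDerivAt.fun_sum fun k _ => ?_) _
          exact HasFDerivAt.comp (W 0) ((hG k) _).hasFDerivAt
            ((tmulCLM (X' k)).hasFDerivAt.add_const (bias 0))
        rw [(hF _).fderiv, (hF _).fderiv]
        congr 1
        ext V
        simp only [ContinuousLinearMap.sum_apply, ContinuousLinearMap.comp_apply,
          tmulCLM_apply, tmulVec_add', hz, add_zero, map_add, Finset.sum_add_distrib]
        rw [add_eq_left]
        have key : ∀ k, fderiv ℝ (G k) (tmulVec (W 0) (X k) + bias 0)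
            (tmulVec V (fun m => P m k)) = ∑ j, ∑ m, V m j * (P m k * D₁ k j) := by
          intro k
          have e : tmulVec V (fun m => P m k) =
              ∑ j, (tmulVec V (fun m => P m k) j) • (Pi.single j (1 : ℝ) : Fin (dims 1) → ℝ) :=
            pi_eq_sum_univ' _
          rw [e, map_sum]
          refine Finset.sum_congr rfl fun j _ => ?_
          rw [map_smul, ← hD, smul_eq_mul, tmulVec, Finset.sum_mul]
          exact Finset.sum_congr rfl fun m _ => by ring
        rw [Finset.sum_congr rfl fun k _ => key k, Finset.sum_comm]
        refine Finset.sum_eq_zero fun j _ => ?_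
        rw [Finset.sum_comm]
        refine Finset.sum_eq_zero fun m _ => ?_
        rw [← Finset.mul_sum, hPD, mul_zero]
      · congr 1
        funext V
        simp only [batchNetLoss]
        congr 1
        refine Finset.sum_congr rfl fun k _ => ?_
        rw [preact_congr h dims _ _ bias bias _ (X k) (fun _ => rfl) (fun _ => rfl) _ L]
        rw [Function.update_of_ne (Nat.succ_ne_zero i).symm, tmulVec_add', hz, add_zero]
    · congr 1
      funext β
      simp only [batchNetLoss]
      congr 1
      refine Finset.sum_congr rfl fun k _ => ?_
      rw [preact_congr h dims W W _ _ _ (X k) (fun _ => rfl) (fun _ => rfl) _ L]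
      rw [tmulVec_add', hz, add_zero]
  · intro hlt
    let T : (Fin (dims 0) → Fin b → ℝ) →ₗ[ℝ]
        (Fin (dims 0) → Fin (dims 1) → ℝ) × (Fin (dims 1) → Fin b → ℝ) :=
      { toFun := fun P => (fun m j => ∑ k, P m k * D₁ k j, fun j k => ∑ m, W 0 m j * P m k)
        map_add' := fun P Q => by
          ext <;> simp [add_mul, mul_add, Finset.sum_add_distrib]
        map_smul' := fun c P => by
          ext <;> simp [Finset.mul_sum, mul_assoc, mul_left_comm] }
    have hT : ∀ P, T P = 0 ↔ (∀ m j, ∑ k, P m k * D₁ k j = 0) ∧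
        (∀ j k, ∑ m, W 0 m j * P m k = 0) := by
      intro P
      simp [T, Prod.ext_iff, funext_iff]
    have hker : LinearMap.ker T ≠ ⊥ := by
      apply LinearMap.ker_ne_bot_of_finrank_lt
      simp only [Module.finrank_prod, Module.finrank_pi_fintype, Module.finrank_self,
        Finset.sum_const, Finset.card_univ, Fintype.card_fin, smul_eq_mul, mul_one]
      nlinarith
    obtain ⟨P, hP, hP0⟩ := (Submodule.ne_bot_iff _).1 hker
    refine ⟨⟨P, hP0, (hT P).1 hP⟩, ?_⟩
    refine Set.infinite_of_injective_forall_mem (f := fun c : ℝ => c • P)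
      (smul_left_injective ℝ hP0) fun c => ?_
    exact (hT _).1 (LinearMap.mem_ker.1 (Submodule.smul_mem _ c hP))
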